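/- Let Ω ⊂ ℝ^d be a nonempty bounded open set and let E be a dyadic function on Ω that is positive and regular. If there exists α > 0 such that τ_E^Ω(p) = τ_E^Ω(0) + α·p for every p ∈ ℝ, then the lower exponent of E is constant: h_E(x) = α for every x ∈ Ω. -/

import Mathlib

open MeasureTheory Filter Metric Set
open scoped ENNReal Topology

noncomputable section

/-- The dyadic cube of scale `j` with index `k`:
`λ = ∏_i [k_i 2^{-j}, (k_i+1) 2^{-j})`. -/
def dyadicCube (d : ℕ) (j : ℕ) (k : Fin d → ℤ) : Set (Fin d → ℝ) :=
  {y | ∀ i, (k i : ℝ) * 2 ^ (-(j : ℤ)) ≤ y i ∧ y i < ((k i : ℝ) + 1) * 2 ^ (-(j : ℤ))}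

/-- The index of the unique dyadic cube of scale `j` containing `x`. -/
def dyadicIndex (d : ℕ) (j : ℕ) (x : Fin d → ℝ) : Fin d → ℤ :=
  fun i => ⌊x i * 2 ^ (j : ℕ)⌋

/-- The lower exponent of a dyadic function `e` at `x`:
`h_E(x) = liminf_{j→∞} log e_{λ_j(x)} / log 2^{-j}`, taken in `[-∞,∞]` with the
convention `log 0 = -∞` (so that the quotient by the negative quantity `log 2^{-j}`
is `+∞` when `e_{λ_j(x)} = 0`). -/
def lowerExp {d : ℕ} (e : ℕ → (Fin d → ℤ) → ℝ) (x : Fin d → ℝ) : EReal :=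
  Filter.liminf
    (fun j : ℕ =>
      if e j (dyadicIndex d j x) = 0 then (⊤ : EReal)
      else ((Real.log (e j (dyadicIndex d j x)) / Real.log ((2 : ℝ) ^ (-(j : ℤ))) : ℝ) : EReal))
    Filter.atTop

/-- The structure function `S_j(ω,p) = Σ_{λ ⊆ ω, ⟨λ⟩ = j} (e_λ)^p` of a dyadic
function `e` on `ω` (a finite sum when `ω` is bounded). -/
def structFn {d : ℕ} (e : ℕ → (Fin d → ℤ) → ℝ) (ω : Set (Fin d → ℝ)) (j : ℕ) (p : ℝ) : ℝ :=
  ∑ᶠ k ∈ {k : Fin d → ℤ | dyadicCube d j k ⊆ ω}, e j k ^ p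

/-- The scaling function `τ_E^ω(p) = liminf_{j→∞} log S_j(ω,p) / log 2^{-j}`. -/
def scalingFn {d : ℕ} (e : ℕ → (Fin d → ℤ) → ℝ) (ω : Set (Fin d → ℝ)) (p : ℝ) : ℝ :=
  Filter.liminf
    (fun j : ℕ => Real.log (structFn e ω j p) / Real.log ((2 : ℝ) ^ (-(j : ℤ))))
    Filter.atTop

/-- The local scaling function `τ_E(x,p) = lim_{r→0⁺} τ_E^{B(x,r)∩Ω}(p)`; since
`r ↦ τ_E^{B(x,r)∩Ω}(p)` is nonincreasing in `r`, the limit equals the supremum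
over `r > 0`. -/
def locScalingFn {d : ℕ} (e : ℕ → (Fin d → ℤ) → ℝ) (Ω : Set (Fin d → ℝ))
    (x : Fin d → ℝ) (p : ℝ) : ℝ :=
  ⨆ r : {r : ℝ // 0 < r}, scalingFn e (Metric.ball x r.1 ∩ Ω) p

/-- The local multifractal spectrum
`d_E(x,H) = lim_{r→0⁺} dim_H {y ∈ B(x,r) ∩ Ω : h_E(y) = H}`; since the spectrum on
`B(x,r) ∩ Ω` is nondecreasing in `r`, the limit equals the infimum over `r > 0`. -/
def locSpectrum {d : ℕ} (e : ℕ → (Fin d → ℤ) → ℝ) (Ω : Set (Fin d → ℝ))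
    (x : Fin d → ℝ) (H : ℝ) : ℝ≥0∞ :=
  ⨅ (r : ℝ) (_ : 0 < r),
    dimH {y ∈ Metric.ball x r ∩ Ω | lowerExp e y = (H : EReal)}

/-- The dyadic function `e` is positive and regular on `Ω`: every `e_λ` with `λ ⊆ Ω`
is positive, and `C₁ 2^{-Bj} ≤ e_λ ≤ C₂ 2^{-Aj}` for all dyadic `λ ⊆ Ω` of scale `j`. -/
def PositiveRegular {d : ℕ} (e : ℕ → (Fin d → ℤ) → ℝ) (Ω : Set (Fin d → ℝ)) : Prop :=
  (∀ j k, dyadicCube d j k ⊆ Ω → 0 < e j k) ∧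
  ∃ C₁ C₂ A B : ℝ, 0 < C₁ ∧ 0 < C₂ ∧
    ∀ j k, dyadicCube d j k ⊆ Ω →
      C₁ * 2 ^ (-(B * j)) ≤ e j k ∧ e j k ≤ C₂ * 2 ^ (-(A * j))

lemma Bornology.IsBounded.exists_dyadicIndexSet_subset {d : ℕ} {Ω : Set (Fin d → ℝ)}
    (hΩ : Bornology.IsBounded Ω) :
    ∃ K : ℝ, 0 < K ∧ ∀ j : ℕ, ∃ F : Finset (Fin d → ℤ),
      {k : Fin d → ℤ | dyadicCube d j k ⊆ Ω} ⊆ F ∧ (F.card : ℝ) ≤ K * 2 ^ ((d : ℝ) * j) := by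
  obtain ⟨R, hR, hΩR⟩ := hΩ.exists_pos_norm_le
  refine ⟨(2 * R + 3) ^ d, by positivity, fun j => ?_⟩
  set N : ℤ := ⌈R * 2 ^ j⌉
  have hN0 : 0 ≤ N := Int.ceil_nonneg (by positivity)
  refine ⟨Fintype.piFinset fun _ => Finset.Icc (-N) N, fun k hk => ?_, ?_⟩
  · have hcorner : (fun i => (k i : ℝ) * 2 ^ (-(j : ℤ))) ∈ dyadicCube d j k := fun i =>
      ⟨le_rfl, by
        have : (0 : ℝ) < 2 ^ (-(j : ℤ)) := by positivity
        nlinarith⟩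
    have hnorm := hΩR _ (hk hcorner)
    simp only [Finset.mem_coe, Fintype.mem_piFinset, Finset.mem_Icc]
    intro i
    have hi := (norm_le_pi_norm _ i).trans hnorm
    rw [Real.norm_eq_abs, abs_mul, zpow_neg, zpow_natCast, abs_inv,
      abs_of_pos (show (0 : ℝ) < 2 ^ j by positivity), ← div_eq_mul_inv, div_le_iff₀ (by positivity)] at hi
    rw [← abs_le]
    have : ((|k i| : ℤ) : ℝ) ≤ N := by
      push_cast
      exact hi.trans (Int.le_ceil _)
    exact_mod_cast this
  · rw [Fintype.card_piFinset_const, Int.card_Icc, mul_comm (d : ℝ), Real.rpow_mul (by norm_num),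
      Real.rpow_natCast, Real.rpow_natCast, ← mul_pow]
    have hcast : (((N + 1 - -N).toNat : ℕ) : ℝ) = 2 * N + 1 := by
      have h : (((N + 1 - -N).toNat : ℕ) : ℤ) = 2 * N + 1 := by omega
      exact_mod_cast h
    rw [Nat.cast_pow, hcast]
    have hlt : (N : ℝ) < R * 2 ^ j + 1 := Int.ceil_lt_add_one _
    have hone : (1 : ℝ) ≤ 2 ^ j := one_le_pow₀ (by norm_num)
    have hN0' : (0 : ℝ) ≤ N := by exact_mod_cast hN0
    gcongr
    nlinarith

lemma finite_setOf_dyadicCube_subset {d : ℕ} {Ω : Set (Fin d → ℝ)}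
    (hΩ : Bornology.IsBounded Ω) (j : ℕ) : {k : Fin d → ℤ | dyadicCube d j k ⊆ Ω}.Finite := by
  obtain ⟨K, -, hK⟩ := hΩ.exists_dyadicIndexSet_subset
  obtain ⟨F, hF, -⟩ := hK j
  exact F.finite_toSet.subset hF

lemma PositiveRegular.exists_rpow_le {d : ℕ} {Ω : Set (Fin d → ℝ)} {e : ℕ → (Fin d → ℤ) → ℝ}
    (hreg : PositiveRegular e Ω) (p : ℝ) :
    ∃ C M : ℝ, 0 < C ∧ ∀ j k, dyadicCube d j k ⊆ Ω → e j k ^ p ≤ C * 2 ^ (M * j) := by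
  obtain ⟨hpos, C₁, C₂, A, B, hC₁, hC₂, hbd⟩ := hreg
  have hpow (C D : ℝ) (j : ℕ) (hC : 0 < C) :
      (C * 2 ^ (-(D * j))) ^ p = C ^ p * (2 : ℝ) ^ (-(D * p) * j) := by
    rw [Real.mul_rpow hC.le (by positivity), ← Real.rpow_mul (by norm_num)]
    ring_nf
  rcases le_total 0 p with hp | hp
  · refine ⟨C₂ ^ p, -(A * p), by positivity, fun j k hk => ?_⟩
    rw [← hpow _ _ _ hC₂]
    exact Real.rpow_le_rpow (hpos j k hk).le (hbd j k hk).2 hp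
  · refine ⟨C₁ ^ p, -(B * p), by positivity, fun j k hk => ?_⟩
    rw [← hpow _ _ _ hC₁]
    exact Real.rpow_le_rpow_of_nonpos (by positivity) (hbd j k hk).1 hp

lemma PositiveRegular.exists_structFn_le {d : ℕ} {Ω : Set (Fin d → ℝ)}
    {e : ℕ → (Fin d → ℤ) → ℝ} (hreg : PositiveRegular e Ω) (hΩ : Bornology.IsBounded Ω) (p : ℝ) :
    ∃ C M : ℝ, 0 < C ∧ ∀ j, structFn e Ω j p ≤ C * 2 ^ (M * j) := by
  obtain ⟨C, M, hC, hle⟩ := hreg.exists_rpow_le p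
  obtain ⟨K, hK, hcard⟩ := hΩ.exists_dyadicIndexSet_subset
  refine ⟨K * C, d + M, by positivity, fun j => ?_⟩
  obtain ⟨F, hF, hFcard⟩ := hcard j
  have hfin := finite_setOf_dyadicCube_subset hΩ j
  rw [structFn, finsum_mem_eq_finite_toFinset_sum _ hfin]
  calc ∑ k ∈ hfin.toFinset, e j k ^ p
      ≤ hfin.toFinset.card • (C * 2 ^ (M * j)) :=
        Finset.sum_le_card_nsmul _ _ _ fun k hk => hle j k (by simpa using hk)
    _ ≤ (K * 2 ^ ((d : ℝ) * j)) * (C * 2 ^ (M * j)) := by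
        rw [nsmul_eq_mul]
        gcongr
        refine le_trans ?_ hFcard
        exact_mod_cast Finset.card_le_card (by simpa using hF)
    _ = K * C * 2 ^ ((d + M) * j) := by
        rw [add_mul, Real.rpow_add (by norm_num)]
        ring

lemma PositiveRegular.rpow_le_structFn {d : ℕ} {Ω : Set (Fin d → ℝ)} {e : ℕ → (Fin d → ℤ) → ℝ}
    (hreg : PositiveRegular e Ω) (hΩ : Bornology.IsBounded Ω) (p : ℝ) {j : ℕ} {k : Fin d → ℤ}
    (hk : dyadicCube d j k ⊆ Ω) : e j k ^ p ≤ structFn e Ω j p := by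
  have hfin := finite_setOf_dyadicCube_subset hΩ j
  rw [structFn, finsum_mem_eq_finite_toFinset_sum _ hfin]
  refine Finset.single_le_sum (f := fun k => e j k ^ p) (fun k' hk' => ?_) (by simpa using hk)
  exact Real.rpow_nonneg (hreg.1 j k' (by simpa using hk')).le p

lemma IsOpen.eventually_dyadicCube_subset {d : ℕ} {Ω : Set (Fin d → ℝ)} (hΩ : IsOpen Ω)
    {x : Fin d → ℝ} (hx : x ∈ Ω) :
    ∀ᶠ j : ℕ in atTop, dyadicCube d j (dyadicIndex d j x) ⊆ Ω := by
  obtain ⟨ε, hε, hball⟩ := Metric.isOpen_iff.1 hΩ x hx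
  have hlim : Tendsto (fun j : ℕ => ((2 : ℝ)⁻¹) ^ j) atTop (𝓝 0) :=
    tendsto_pow_atTop_nhds_zero_of_lt_one (by norm_num) (by norm_num)
  filter_upwards [hlim.eventually_lt_const hε] with j hj y hy
  refine hball ((dist_pi_lt_iff hε).2 fun i => lt_of_le_of_lt ?_ hj)
  have hyi := hy i
  have hp : (0 : ℝ) < 2 ^ j := by positivity
  simp only [dyadicIndex, zpow_neg, zpow_natCast, ← div_eq_mul_inv] at hyi
  rw [div_le_iff₀ hp, lt_div_iff₀ hp] at hyi
  have h₁ := Int.floor_le (x i * 2 ^ j)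
  have h₂ := Int.lt_floor_add_one (x i * 2 ^ j)
  rw [inv_pow, ← one_div, le_div_iff₀ hp, Real.dist_eq, ← abs_of_pos hp, ← abs_mul, abs_le]
  constructor <;> linarith [hyi.1, hyi.2, sub_mul (y i) (x i) (2 ^ j)]

lemma log_two_zpow_neg_natCast (j : ℕ) : Real.log ((2 : ℝ) ^ (-(j : ℤ))) = -(j * Real.log 2) := by
  rw [Real.log_zpow]
  push_cast
  ring

lemma PositiveRegular.eventually_lt_mul_exponent {d : ℕ} {Ω : Set (Fin d → ℝ)}
    {e : ℕ → (Fin d → ℤ) → ℝ} (hreg : PositiveRegular e Ω) (hΩo : IsOpen Ω)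
    (hΩb : Bornology.IsBounded Ω) {x : Fin d → ℝ} (hx : x ∈ Ω) {p t : ℝ}
    (ht : t < scalingFn e Ω p) :
    ∀ᶠ j : ℕ in atTop, t < p * (Real.log (e j (dyadicIndex d j x)) /
      Real.log ((2 : ℝ) ^ (-(j : ℤ)))) := by
  have hsub := hΩo.eventually_dyadicCube_subset hx
  have hlog2 : 0 < Real.log 2 := Real.log_pos (by norm_num)
  have hbdd : IsBoundedUnder (· ≥ ·) atTop (fun j : ℕ =>
      Real.log (structFn e Ω j p) / Real.log ((2 : ℝ) ^ (-(j : ℤ)))) := by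
    obtain ⟨C, M, hC, hle⟩ := hreg.exists_structFn_le hΩb p
    refine isBoundedUnder_of_eventually_ge (a := -(|Real.log C| / Real.log 2) - M) ?_
    filter_upwards [hsub, eventually_ge_atTop 1] with j hj hj1
    have hS : 0 < structFn e Ω j p :=
      (Real.rpow_pos_of_pos (hreg.1 _ _ hj) p).trans_le (hreg.rpow_le_structFn hΩb p hj)
    have hlog := Real.log_le_log hS (hle j)
    rw [Real.log_mul hC.ne' (by positivity), Real.log_rpow (by norm_num)] at hlog
    have hj1' : (1 : ℝ) ≤ j := by exact_mod_cast hj1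
    rw [log_two_zpow_neg_natCast, div_neg, ← neg_add', neg_le_neg_iff,
      div_le_iff₀ (by positivity)]
    have hexp : (|Real.log C| / Real.log 2 + M) * (j * Real.log 2) =
        |Real.log C| * j + M * j * Real.log 2 := by
      field_simp
    rw [hexp]
    nlinarith [le_abs_self (Real.log C), abs_nonneg (Real.log C)]
  filter_upwards [eventually_lt_of_lt_liminf ht hbdd, hsub, eventually_ge_atTop 1]
    with j hj hjs hj1
  have he := hreg.1 _ _ hjs
  refine hj.trans_le ?_
  rw [← mul_div_assoc, ← Real.log_rpow he]
  refine div_le_div_of_nonpos_of_le ?_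
    (Real.log_le_log (by positivity) (hreg.rpow_le_structFn hΩb p hjs))
  rw [log_two_zpow_neg_natCast]
  exact neg_nonpos.2 (by positivity)

lemma tendsto_of_forall_eventually_add_mul_lt {ι : Type*} {l : Filter ι} {u : ι → ℝ} {c α : ℝ}
    (h : ∀ p : ℝ, ∀ᶠ j in l, c + α * p < p * u j) : Tendsto u l (𝓝 α) := by
  rw [Metric.tendsto_nhds]
  intro ε hε
  have hP : 0 < |c| + 1 := by positivity
  filter_upwards [h ((|c| + 1) / ε), h (-((|c| + 1) / ε))] with j h₁ h₂
  have hc := neg_abs_le c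
  have hq : 0 < (|c| + 1) / ε := by positivity
  have hqε : (|c| + 1) / ε * ε = |c| + 1 := by field_simp
  rw [Real.dist_eq, abs_lt]
  constructor
  · refine lt_of_mul_lt_mul_left ?_ hq.le
    linarith [mul_neg ((|c| + 1) / ε) ε, mul_sub ((|c| + 1) / ε) (u j) α,
      mul_comm α ((|c| + 1) / ε)]
  · refine lt_of_mul_lt_mul_left ?_ hq.le
    linarith [mul_sub ((|c| + 1) / ε) (u j) α, mul_comm α ((|c| + 1) / ε)]

/-- If the scaling function of a positive regular dyadic function `E` on a nonempty
bounded open set `Ω` is affine, `τ_E^Ω(p) = τ_E^Ω(0) + α p` with `α > 0`, then the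
lower exponent of `E` is constant, equal to `α`, on `Ω`. -/
theorem lowerExp_const_of_affine_scalingFn {d : ℕ} (Ω : Set (Fin d → ℝ))
    (hΩo : IsOpen Ω) (hΩne : Ω.Nonempty) (hΩb : Bornology.IsBounded Ω)
    (e : ℕ → (Fin d → ℤ) → ℝ) (hreg : PositiveRegular e Ω)
    (α : ℝ) (hα : 0 < α)
    (haff : ∀ p : ℝ, scalingFn e Ω p = scalingFn e Ω 0 + α * p) :
    ∀ x ∈ Ω, lowerExp e x = (α : EReal) := by
  intro x hx
  have hlim := tendsto_of_forall_eventually_add_mul_lt (c := scalingFn e Ω 0 - 1) (α := α)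
    fun p => hreg.eventually_lt_mul_exponent hΩo hΩb hx (p := p) (by rw [haff p]; linarith)
  refine Tendsto.liminf_eq ((EReal.tendsto_coe.2 hlim).congr' ?_)
  filter_upwards [hΩo.eventually_dyadicCube_subset hx] with j hj
  rw [if_neg (hreg.1 _ _ hj).ne']

end
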